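/- For any 0 ≤ p < n and any probability measure η on E_p, the following two measures on E_p × ⋯ × E_n coincide: (ηQ_{p,n})(dx_n) ∏_{p≤q<n} M_{q+1,Φ_{p,q}(η)}(x_{q+1}, dx_q) = η(dx_p) ∏_{p≤q<n} Q_{q+1}(x_q, dx_{q+1}), where Φ_{p,q}(η) := ηQ_{p,q}/ηQ_{p,q}(1). (Lemma 4.2.) -/

import Mathlib

open MeasureTheory ProbabilityTheory ENNReal

noncomputable section

variable {E : ℕ → Type*} [∀ n, MeasurableSpace (E n)]

/-- Normalization `μ / μ(1)` of a measure. -/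
def nz {α : Type*} [MeasurableSpace α] (μ : Measure α) : Measure α := (μ Set.univ)⁻¹ • μ

variable (M : ∀ n, Kernel (E n) (E (n+1))) (G : ∀ n, E n → ℝ) (H : ∀ n, E n → E (n+1) → ℝ)

/-- The Feynman-Kac kernel `Q_{q+1}(x,dy) = G_q(x) M_{q+1}(x,dy)`. -/
def Qk (q : ℕ) (x : E q) : Measure (E (q+1)) := ENNReal.ofReal (G q x) • (M q x : Measure (E (q+1)))

/-- The backward kernel `M_{q+1,η}(y,dx) = G_q(x) H_{q+1}(x,y) η(dx) / η(G_q H_{q+1}(·,y))`. -/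
def Mback (q : ℕ) (η : Measure (E q)) (y : E (q+1)) : Measure (E q) :=
  (∫⁻ x, ENNReal.ofReal (G q x * H q x y) ∂η)⁻¹ •
    η.withDensity fun x => ENNReal.ofReal (G q x * H q x y)

/-- The unnormalized Feynman-Kac marginal `γ_n = η₀ Q_{0,n}`. -/
def gamma (η0 : Measure (E 0)) : ∀ n, Measure (E n)
  | 0 => η0
  | n + 1 => (gamma η0 n).bind (Qk M G n)

/-- The Boltzmann-Gibbs transform `Ψ_{G_q}(η)(dx) = G_q(x) η(dx) / η(G_q)`. -/
def PsiG (q : ℕ) (η : Measure (E q)) : Measure (E q) :=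
  (∫⁻ x, ENNReal.ofReal (G q x) ∂η)⁻¹ • η.withDensity fun x => ENNReal.ofReal (G q x)

/-- `Φ_{q+1}(η) = Ψ_{G_q}(η) M_{q+1}`. -/
def Phi (q : ℕ) (η : Measure (E q)) : Measure (E (q+1)) :=
  (PsiG G q η).bind fun x => (M q x : Measure (E (q+1)))

/-- `η Q_{p,q}` as a measure on `E q` (junk `0` for `q < p`). -/
def QQabs (p : ℕ) (η : Measure (E p)) : ∀ q, Measure (E q)
  | 0 => if h : p = 0 then cast (congrArg (fun m => Measure (E m)) h) η else 0
  | q + 1 =>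
      if h : p = q + 1 then cast (congrArg (fun m => Measure (E m)) h) η
      else (QQabs p η q).bind (Qk M G q)

/-- Forward segment integral: `x_p ↦ ∫ ∏_{p ≤ q < p+k} Q_{q+1}(x_q, dx_{q+1}) F(x_p,…,x_{p+k})`. -/
def fwdSeg (p : ℕ) : (k : ℕ) → E p → ((∀ i : Fin (k+1), E (p + ↑i)) → ℝ) → ℝ
  | 0, x, F => F (Fin.cons x fun j => j.elim0)
  | k + 1, x, F =>
      fwdSeg p k x fun xs => ∫ y, F (Fin.snoc xs y) ∂ (Qk M G (p + k) (xs (Fin.last k)))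

/-- Backward segment integral from `x_{p+k}`:
`x_{p+k} ↦ ∫ ∏_{p ≤ q < p+k} M_{q+1,θ_q}(x_{q+1}, dx_q) F(x_p,…,x_{p+k})`. -/
def bwdSeg (θ : ∀ q, Measure (E q)) (p : ℕ) :
    (k : ℕ) → E (p + k) → ((∀ i : Fin (k+1), E (p + ↑i)) → ℝ) → ℝ
  | 0, x, F => F (Fin.cons x fun j => j.elim0)
  | k + 1, x, F =>
      ∫ y, bwdSeg θ p k y (fun xs => F (Fin.snoc xs x)) ∂ (Mback G H (p + k) (θ (p + k)) x)

/-- Backward integral from level `p` down to level `0`: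
`x_p ↦ ∫ ∏_{q=1}^{p} M_{q,θ_{q-1}}(x_q, dx_{q-1}) F(x_0,…,x_p)`. -/
def bwd0 (θ : ∀ q, Measure (E q)) : (p : ℕ) → E p → ((∀ i : Fin (p+1), E ↑i) → ℝ) → ℝ
  | 0, x, F => F (Fin.cons x fun j => j.elim0)
  | p + 1, x, F => ∫ y, bwd0 θ p y (fun xs => F (Fin.snoc xs x)) ∂ (Mback G H p (θ p) x)

/-- Integrate out the coordinates `p+1,…,n` of `F` forward through the `Q` chain. -/
def fwdAbs (p : ℕ) : (n : ℕ) → ((∀ i : Fin (n+1), E ↑i) → ℝ) → (∀ i : Fin (p+1), E ↑i) → ℝ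
  | 0, F => fun xs => F fun i => xs (Fin.castLE (by omega) i)
  | n + 1, F =>
      if h : n + 1 ≤ p then fun xs => F fun i => xs (Fin.castLE (by omega) i)
      else fwdAbs p n fun xs => ∫ y, F (Fin.snoc xs y) ∂ (Qk M G n (xs (Fin.last n)))

/-- The operator `D_{p,n}` associated to the family of backward measures `θ`. -/
def Dop (θ : ∀ q, Measure (E q)) (p n : ℕ) (F : (∀ i : Fin (n+1), E ↑i) → ℝ) (x : E p) : ℝ :=
  bwd0 G H θ p x (fwdAbs M G p n F)

/-- `Γ_n(F)`, the unnormalized Feynman-Kac path integral. -/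
def GammaInt (η0 : Measure (E 0)) : (n : ℕ) → ((∀ i : Fin (n+1), E ↑i) → ℝ) → ℝ
  | 0, F => ∫ x, F (Fin.cons x fun j => j.elim0) ∂ η0
  | n + 1, F => GammaInt η0 n fun xs => ∫ y, F (Fin.snoc xs y) ∂ (Qk M G n (xs (Fin.last n)))

/-- `Q_{p,n}(f)` acting on functions (junk `0` if `n < p`). -/
def Qfun (p : ℕ) : (n : ℕ) → (E n → ℝ) → E p → ℝ
  | 0, f => if h : p = 0 then fun x => f (cast (congrArg E h) x) else 0
  | n + 1, f =>
      if h : p = n + 1 then fun x => f (cast (congrArg E h) x)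
      else Qfun p n fun x => ∫ y, f y ∂ (Qk M G n x)

/-- The composition `M_{n,θ_{n-1}} M_{n-1,θ_{n-2}} ⋯ M_{p+1,θ_p}` acting on functions on `E p`
(identity when `n = p`, junk `0` if `n < p`). -/
def Mchain (θ : ∀ q, Measure (E q)) (p : ℕ) : (n : ℕ) → (E p → ℝ) → E n → ℝ
  | 0, f => if h : p = 0 then fun x => f (cast (congrArg E h.symm) x) else 0
  | n + 1, f =>
      if h : p = n + 1 then fun x => f (cast (congrArg E h.symm) x)
      else fun x => ∫ y, Mchain θ p n f y ∂ (Mback G H n (θ n) x)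

/-- The forward recursion `F_0 = f_0`, `F_{p+1} = f_{p+1} + M_{p+1,θ_p}(F_p)`. -/
def Frec (θ : ∀ q, Measure (E q)) (f : ∀ q, E q → ℝ) : ∀ p, E p → ℝ
  | 0 => f 0
  | p + 1 => fun x => f (p+1) x + ∫ y, Frec θ f p y ∂ (Mback G H p (θ p) x)

/-- Glue a path `(x_0,…,x_p)` with a segment `(x_p,…,x_{p+k})`. -/
def glue (p k : ℕ) (xs : ∀ i : Fin (p+1), E ↑i) (ys : ∀ i : Fin (k+1), E (p + ↑i)) :
    ∀ i : Fin (p+k+1), E ↑i := fun i =>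
  if h : (i : ℕ) ≤ p then xs ⟨i, by omega⟩
  else cast (congrArg E (show p + ((i : ℕ) - p) = (i : ℕ) by omega))
    (ys ⟨(i : ℕ) - p, by have := i.isLt; omega⟩)

/-- The oscillation `osc(f) = sup_{x,y} |f x - f y|`. -/
def osc {α : Type*} (f : α → ℝ) : ℝ := sSup {d | ∃ x y, d = |f x - f y|}

/-- The Dobrushin contraction coefficient of an operator mapping functions on `α`
to functions on `β`. -/
def betaOp {α β : Type*} [MeasurableSpace α] (T : (α → ℝ) → β → ℝ) : ℝ :=
  sSup {r | ∃ φ : α → ℝ, Measurable φ ∧ (∀ x y, |φ x - φ y| ≤ 1) ∧ r = osc (T φ)}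

/-- Empirical measure of an `N`-tuple. -/
def emp {α : Type*} [MeasurableSpace α] {N : ℕ} (x : Fin N → α) : Measure α :=
  (N : ℝ≥0∞)⁻¹ • ∑ i, Measure.dirac (x i)


theorem compProd_eq_map_swap_of_density {α β : Type*} [MeasurableSpace α] [MeasurableSpace β]
    (ν : Measure α) [SFinite ν] (Q : Kernel α β) [IsSFiniteKernel Q] (K : Kernel β α)
    [IsSFiniteKernel K] (l : Measure β) [SFinite l] (d : α → β → ℝ≥0∞)
    (hd : Measurable (Function.uncurry d)) (hQ : ∀ x, Q x = l.withDensity (d x))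
    (hK : ∀ y, K y = (∫⁻ x, d x y ∂ν)⁻¹ • ν.withDensity fun x => d x y)
    (h0 : ∀ y, ∫⁻ x, d x y ∂ν ≠ 0) (hfin : ∀ y, ∫⁻ x, d x y ∂ν ≠ ⊤) :
    ν ⊗ₘ Q = ((Q ∘ₘ ν) ⊗ₘ K).map Prod.swap := by
  have hd1 : ∀ x, Measurable (d x) := fun x => hd.of_uncurry_left
  have hd2 : ∀ y, Measurable fun x => d x y := fun y => hd.of_uncurry_right
  refine Measure.ext_of_lintegral _ fun f hf => ?_
  have hf1 : ∀ x, Measurable fun y => f (x, y) := fun x => hf.comp measurable_prodMk_left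
  have hf2 : ∀ y, Measurable fun x => f (x, y) := fun y => hf.comp measurable_prodMk_right
  have hKf : Measurable fun y => ∫⁻ x, f (x, y) ∂(K y) :=
    Measurable.lintegral_kernel_prod_right' (κ := K) (f := fun z : β × α => f z.swap)
      (hf.comp measurable_swap)
  have hdf : Measurable fun z : α × β => d z.1 z.2 * f z := hd.mul hf
  rw [Measure.lintegral_compProd hf, lintegral_map hf measurable_swap,
    Measure.lintegral_compProd (f := fun z : β × α => f z.swap) (hf.comp measurable_swap)]
  simp only [Prod.swap_prod_mk]
  rw [Measure.lintegral_bind Q.measurable.aemeasurable hKf.aemeasurable]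
  have hL : ∀ x, ∫⁻ y, f (x, y) ∂(Q x) = ∫⁻ y, d x y * f (x, y) ∂l := fun x => by
    rw [hQ, lintegral_withDensity_eq_lintegral_mul _ (hd1 x) (hf1 x)]; rfl
  have hR : ∀ x, ∫⁻ y, ∫⁻ x', f (x', y) ∂(K y) ∂(Q x)
      = ∫⁻ y, d x y * ∫⁻ x', f (x', y) ∂(K y) ∂l := fun x => by
    rw [hQ, lintegral_withDensity_eq_lintegral_mul _ (hd1 x) hKf]; rfl
  simp only [hL, hR]
  rw [lintegral_lintegral_swap hdf.aemeasurable, lintegral_lintegral_swap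
    (f := fun x y => d x y * ∫⁻ x', f (x', y) ∂(K y))
    (hd.mul (hKf.comp measurable_snd)).aemeasurable]
  refine lintegral_congr fun y => ?_
  rw [lintegral_mul_const _ (hd2 y), hK, lintegral_smul_measure,
    lintegral_withDensity_eq_lintegral_mul _ (hd2 y) (hf2 y), smul_eq_mul, ← mul_assoc,
    ENNReal.mul_inv_cancel (h0 y) (hfin y), one_mul]
  rfl

/-- The path with the single point `x_p`. -/
def pathSingle (p : ℕ) (x : E (p + 0)) : ∀ i : Fin (0 + 1), E (p + ↑i) :=
  Fin.cons x fun j => j.elim0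

/-- Append the point `x_{p+k+1}` to the path `(x_p, …, x_{p+k})`. -/
def pathSnoc (p k : ℕ) (xs : ∀ i : Fin (k + 1), E (p + ↑i)) (y : E (p + k + 1)) :
    ∀ i : Fin (k + 1 + 1), E (p + ↑i) :=
  Fin.snoc (α := fun i : Fin (k + 1 + 1) => E (p + ↑i)) xs y

theorem measurable_pathSnoc (p k : ℕ) :
    Measurable fun z : (∀ i : Fin (k + 1), E (p + ↑i)) × E (p + k + 1) =>
      pathSnoc p k z.1 z.2 := by
  refine measurable_pi_iff.2 fun i => ?_
  induction i using Fin.lastCases with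
  | last =>
    simp only [pathSnoc, Fin.snoc_last]
    exact measurable_snd
  | cast i =>
    simp only [pathSnoc, Fin.snoc_castSucc]
    exact (measurable_pi_apply i).comp measurable_fst

theorem measurable_pathSingle (p : ℕ) : Measurable (pathSingle (E := E) p) := by
  refine measurable_pi_iff.2 fun i => ?_
  induction i using Fin.cases with
  | zero => exact measurable_id
  | succ j => exact j.elim0

/-- The law of the backward path `(x_p, …, x_{p+k})` started from `x_{p+k}`, for the backward
transition kernels `K`. -/
def bwdPath (p : ℕ) (K : ∀ j, Kernel (E (p + j + 1)) (E (p + j))) :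
    ∀ k : ℕ, Kernel (E (p + k)) (∀ i : Fin (k + 1), E (p + ↑i))
  | 0 => Kernel.deterministic (pathSingle p) (measurable_pathSingle p)
  | k + 1 => ((bwdPath p K k ∘ₖ K k) ×ₖ Kernel.id).map fun z => pathSnoc p k z.1 z.2

theorem isMarkovKernel_bwdPath (p : ℕ) (K : ∀ j, Kernel (E (p + j + 1)) (E (p + j)))
    (hK : ∀ j, IsMarkovKernel (K j)) (k : ℕ) : IsMarkovKernel (bwdPath p K k) := by
  induction k with
  | zero => rw [bwdPath]; infer_instance
  | succ k ih => rw [bwdPath]; exact Kernel.IsMarkovKernel.map _ (measurable_pathSnoc p k)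

theorem integrable_of_bounded {α : Type*} [MeasurableSpace α] {μ : Measure α} [IsFiniteMeasure μ]
    {f : α → ℝ} (hf : Measurable f) {C : ℝ} (hC : ∀ x, |f x| ≤ C) : Integrable f μ :=
  Integrable.of_bound hf.aestronglyMeasurable C (ae_of_all _ hC)

theorem bwdSeg_eq_integral (p : ℕ) (K : ∀ j, Kernel (E (p + j + 1)) (E (p + j)))
    (hK : ∀ j, IsMarkovKernel (K j)) (θ : ∀ q, Measure (E q)) (k : ℕ)
    (hKθ : ∀ j < k, ∀ y, K j y = Mback G H (p + j) (θ (p + j)) y)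
    (x : E (p + k)) (F : (∀ i : Fin (k + 1), E (p + ↑i)) → ℝ) (hF : Measurable F)
    {C : ℝ} (hC : ∀ xs, |F xs| ≤ C) :
    bwdSeg G H θ p k x F = ∫ xs, F xs ∂(bwdPath p K k x) := by
  induction k with
  | zero =>
    rw [bwdPath, Kernel.deterministic_apply, integral_dirac' _ _ hF.stronglyMeasurable]
    rfl
  | succ k ih =>
    have := isMarkovKernel_bwdPath p K hK k
    have hs := measurable_pathSnoc (E := E) p k
    have hFs : Measurable fun xs => F (pathSnoc p k xs x) :=
      hF.comp (hs.comp measurable_prodMk_right)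
    have hint : Integrable (fun z => F (pathSnoc p k z.1 z.2))
        (((bwdPath p K k ∘ₖ K k) x).prod (Measure.dirac x)) :=
      integrable_of_bounded (hF.comp hs) fun _ => hC _
    have hd : ∀ xs, ∫ y, F (pathSnoc p k xs y) ∂(Measure.dirac x) = F (pathSnoc p k xs x) :=
      fun xs => integral_dirac' _ _ (hF.comp (hs.comp measurable_prodMk_left)).stronglyMeasurable
    calc bwdSeg G H θ p (k + 1) x F
        = ∫ y, bwdSeg G H θ p k y (fun xs => F (pathSnoc p k xs x)) ∂(K k x) := by
          rw [hKθ k (Nat.lt_succ_self k)]; rfl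
      _ = ∫ y, ∫ xs, F (pathSnoc p k xs x) ∂(bwdPath p K k y) ∂(K k x) :=
          integral_congr_ae (ae_of_all _ fun y =>
            ih (fun j hj => hKθ j (by omega)) y _ hFs fun _ => hC _)
      _ = ∫ xs, F (pathSnoc p k xs x) ∂((bwdPath p K k ∘ₖ K k) x) :=
          (Kernel.integral_comp (integrable_of_bounded hFs fun _ => hC _)).symm
      _ = ∫ z, F (pathSnoc p k z.1 z.2)
            ∂(((bwdPath p K k ∘ₖ K k) x).prod (Measure.dirac x)) := by
          rw [integral_prod _ hint]; simp only [hd]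
      _ = ∫ xs, F xs ∂((((bwdPath p K k ∘ₖ K k) ×ₖ Kernel.id).map
            fun z => pathSnoc p k z.1 z.2) x) := by
          rw [Kernel.map_apply _ hs, integral_map hs.aemeasurable hF.aestronglyMeasurable,
            Kernel.prod_apply, Kernel.id_apply]
          rfl

theorem bwdSeg_congr (θ : ∀ q, Measure (E q)) (p k : ℕ) (x : E (p + k))
    (F F' : (∀ i : Fin (k + 1), E (p + ↑i)) → ℝ)
    (h : ∀ xs, xs (Fin.last k) = x → F xs = F' xs) :
    bwdSeg G H θ p k x F = bwdSeg G H θ p k x F' := by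
  cases k with
  | zero => exact h _ rfl
  | succ k =>
    rw [bwdSeg, bwdSeg]
    congr 1
    funext y
    congr 1
    funext xs
    exact h _ (Fin.snoc_last (α := fun i : Fin (k + 2) => E (p + ↑i)) _ _)

theorem QQabs_self (p : ℕ) (η : Measure (E p)) : QQabs M G p η p = η := by
  cases p <;> simp [QQabs]

theorem QQabs_add_succ (p k : ℕ) (η : Measure (E p)) :
    QQabs M G p η (p + k + 1) = (QQabs M G p η (p + k)).bind (Qk M G (p + k)) := by
  rw [QQabs, dif_neg (by omega)]

/-- `Qk` as a kernel. -/
def QkKernel (hGm : ∀ q, Measurable (G q)) (q : ℕ) : Kernel (E q) (E (q + 1)) where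
  toFun := Qk M G q
  measurable' := by
    refine Measure.measurable_of_measurable_coe _ fun s hs => ?_
    simp only [Qk, Measure.smul_apply, smul_eq_mul]
    exact (hGm q).ennreal_ofReal.mul ((M q).measurable_coe hs)

theorem isFiniteKernel_QkKernel (hM : ∀ q, IsMarkovKernel (M q)) (hGm : ∀ q, Measurable (G q))
    (hG : ∀ q x, G q x ∈ Set.Ioc (0 : ℝ) 1) (q : ℕ) : IsFiniteKernel (QkKernel M G hGm q) := by
  refine ⟨1, ENNReal.one_lt_top, fun x => ?_⟩
  change Qk M G q x Set.univ ≤ 1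
  have := hM q
  simpa [Qk] using (hG q x).2

/-- `Mback` as a kernel. -/
def MbackKernel (hGm : ∀ q, Measurable (G q)) (hHm : ∀ q, Measurable (Function.uncurry (H q)))
    (q : ℕ) (ν : Measure (E q)) [SFinite ν] : Kernel (E (q + 1)) (E q) where
  toFun := Mback G H q ν
  measurable' := by
    have hd : Measurable fun z : E (q + 1) × E q => ENNReal.ofReal (G q z.2 * H q z.2 z.1) :=
      (((hGm q).comp measurable_snd).mul ((hHm q).comp measurable_swap)).ennreal_ofReal
    refine Measure.measurable_of_measurable_coe _ fun s hs => ?_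
    simp only [Mback, Measure.smul_apply, smul_eq_mul, withDensity_apply _ hs]
    exact hd.lintegral_prod_right'.inv.mul hd.lintegral_prod_right'

theorem lintegral_density_ne_zero (hG : ∀ q x, G q x ∈ Set.Ioc (0 : ℝ) 1)
    (hGm : ∀ q, Measurable (G q)) (hHm : ∀ q, Measurable (Function.uncurry (H q)))
    (hHpos : ∀ q x y, 0 < H q x y) (q : ℕ) (ν : Measure (E q)) (hν : ν ≠ 0) (y : E (q + 1)) :
    ∫⁻ x, ENNReal.ofReal (G q x * H q x y) ∂ν ≠ 0 := by
  have hm : Measurable fun x => ENNReal.ofReal (G q x * H q x y) :=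
    ((hGm q).mul (hHm q).of_uncurry_right).ennreal_ofReal
  rw [← pos_iff_ne_zero, lintegral_pos_iff_support hm]
  have : Function.support (fun x => ENNReal.ofReal (G q x * H q x y)) = Set.univ := by
    refine Set.eq_univ_of_forall fun x => ?_
    simpa using mul_pos (hG q x).1 (hHpos q x y)
  rwa [this, Measure.measure_univ_pos]

theorem isProbabilityMeasure_nz {α : Type*} [MeasurableSpace α] (μ : Measure α) [IsFiniteMeasure μ]
    (hμ : μ ≠ 0) : IsProbabilityMeasure (nz μ) := by
  refine ⟨?_⟩
  rw [nz, Measure.smul_apply, smul_eq_mul, ENNReal.inv_mul_cancel]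
  · rwa [Ne, Measure.measure_univ_eq_zero]
  · exact measure_ne_top _ _

theorem QQabs_add_finite_ne_zero (hM : ∀ q, IsMarkovKernel (M q)) (hGm : ∀ q, Measurable (G q))
    (hG : ∀ q x, G q x ∈ Set.Ioc (0 : ℝ) 1) (p k : ℕ) (η : Measure (E p))
    [IsProbabilityMeasure η] :
    IsFiniteMeasure (QQabs M G p η (p + k)) ∧ QQabs M G p η (p + k) ≠ 0 := by
  induction k with
  | zero =>
    change IsFiniteMeasure (QQabs M G p η p) ∧ QQabs M G p η p ≠ 0
    rw [QQabs_self]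
    exact ⟨inferInstance, IsProbabilityMeasure.ne_zero η⟩
  | succ k ih =>
    obtain ⟨hfin, hne⟩ := ih
    have := isFiniteKernel_QkKernel M G hM hGm hG (p + k)
    have hMk := hM (p + k)
    have hQ : QQabs M G p η (p + (k + 1)) = QkKernel M G hGm (p + k) ∘ₘ QQabs M G p η (p + k) :=
      QQabs_add_succ M G p k η
    rw [hQ]
    refine ⟨inferInstance, fun h => ?_⟩
    have h1 : (QkKernel M G hGm (p + k) ∘ₘ QQabs M G p η (p + k)) Set.univ = 0 := by rw [h]; rfl
    rw [Measure.bind_apply .univ (Kernel.aemeasurable _),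
      lintegral_eq_zero_iff (Kernel.measurable_coe _ .univ)] at h1
    have h2 : ∀ x, QkKernel M G hGm (p + k) x Set.univ ≠ 0 := fun x => by
      change Qk M G (p + k) x Set.univ ≠ 0
      simpa [Qk] using (hG (p + k) x).1
    have h3 : ∀ᵐ x ∂(QQabs M G p η (p + k)), False := by
      filter_upwards [h1] with x hx using h2 x hx
    exact hne (ae_eq_bot.1 (Filter.eventually_false_iff_eq_bot.1 h3))

theorem Qk_eq_withDensity (lam : ∀ n, Measure (E n)) (hG : ∀ q x, G q x ∈ Set.Ioc (0 : ℝ) 1)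
    (hHm : ∀ q, Measurable (Function.uncurry (H q)))
    (hMH : ∀ q x, (M q x : Measure (E (q + 1)))
      = (lam (q + 1)).withDensity fun y => ENNReal.ofReal (H q x y)) (q : ℕ) (x : E q) :
    Qk M G q x = (lam (q + 1)).withDensity fun y => ENNReal.ofReal (G q x * H q x y) := by
  rw [Qk, hMH, ← withDensity_smul _ (hHm q).of_uncurry_left.ennreal_ofReal]
  congr 1
  funext y
  rw [Pi.smul_apply, smul_eq_mul, ENNReal.ofReal_mul (hG q x).1.le]

theorem isMarkovKernel_MbackKernel (hGm : ∀ q, Measurable (G q))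
    (hHm : ∀ q, Measurable (Function.uncurry (H q))) (q : ℕ) (ν : Measure (E q)) [SFinite ν]
    (h0 : ∀ y, ∫⁻ x, ENNReal.ofReal (G q x * H q x y) ∂ν ≠ 0)
    (hfin : ∀ y, ∫⁻ x, ENNReal.ofReal (G q x * H q x y) ∂ν ≠ ⊤) :
    IsMarkovKernel (MbackKernel G H hGm hHm q ν) := by
  refine ⟨fun y => ⟨?_⟩⟩
  change Mback G H q ν y Set.univ = 1
  rw [Mback, Measure.smul_apply, withDensity_apply _ .univ, Measure.restrict_univ, smul_eq_mul,
    ENNReal.inv_mul_cancel (h0 y) (hfin y)]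

theorem eq_smul_nz {α : Type*} [MeasurableSpace α] (μ : Measure α) [IsFiniteMeasure μ]
    (hμ : μ ≠ 0) : μ = μ Set.univ • nz μ := by
  rw [nz, smul_smul, ENNReal.mul_inv_cancel, one_smul]
  · rwa [Ne, Measure.measure_univ_eq_zero]
  · exact measure_ne_top _ _

/-- Lemma 4.2. For any `0 ≤ p < n` (here `n = p + k`, `1 ≤ k`) and any
probability measure `η` on `E_p`, the measures
`(ηQ_{p,n})(dx_n) ∏_{p≤q<n} M_{q+1,Φ_{p,q}(η)}(x_{q+1},dx_q)` and
`η(dx_p) ∏_{p≤q<n} Q_{q+1}(x_q,dx_{q+1})` on `E_p × ⋯ × E_n` coincide,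
where `Φ_{p,q}(η) = ηQ_{p,q} / ηQ_{p,q}(1)`. -/
theorem backward_transport_lemma
    (lam : ∀ n, Measure (E n))
    (hM : ∀ q, IsMarkovKernel (M q))
    (hGm : ∀ q, Measurable (G q)) (hG : ∀ q x, G q x ∈ Set.Ioc (0:ℝ) 1)
    (hHm : ∀ q, Measurable (Function.uncurry (H q)))
    (hHpos : ∀ q x y, 0 < H q x y)
    (hlam : ∀ n, SigmaFinite (lam n))
    (hMH : ∀ q x, (M q x : Measure (E (q+1)))
      = (lam (q+1)).withDensity fun y => ENNReal.ofReal (H q x y))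
    (hHint : ∀ q (η : Measure (E q)), IsProbabilityMeasure η → ∀ y,
      ∫⁻ x, ENNReal.ofReal (G q x * H q x y) ∂η < ⊤)
    (p k : ℕ) (hk : 1 ≤ k) (η : Measure (E p)) (hη : IsProbabilityMeasure η)
    (F : (∀ i : Fin (k+1), E (p + ↑i)) → ℝ) (hFm : Measurable F) (hFb : ∃ C, ∀ x, |F x| ≤ C) :
    ∫ x, bwdSeg G H (fun q => nz (QQabs M G p η q)) p k x F ∂ (QQabs M G p η (p+k))
      = ∫ x, fwdSeg M G p k x F ∂ η := by
  clear hk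
  set θ : ∀ q, Measure (E q) := fun q => nz (QQabs M G p η q)
  have hprop := QQabs_add_finite_ne_zero M G hM hGm hG p (η := η)
  have hfinite : ∀ j, IsFiniteMeasure (QQabs M G p η (p + j)) := fun j => (hprop j).1
  have hθp : ∀ j, IsProbabilityMeasure (θ (p + j)) := fun j =>
    isProbabilityMeasure_nz _ (hprop j).2
  have h0 : ∀ j y, ∫⁻ x, ENNReal.ofReal (G (p + j) x * H (p + j) x y) ∂(θ (p + j)) ≠ 0 :=
    fun j => lintegral_density_ne_zero G H hG hGm hHm hHpos _ _ (IsProbabilityMeasure.ne_zero _)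
  have htop : ∀ j y, ∫⁻ x, ENNReal.ofReal (G (p + j) x * H (p + j) x y) ∂(θ (p + j)) ≠ ⊤ :=
    fun j y => (hHint _ _ (hθp j) y).ne
  let K : ∀ j, Kernel (E (p + j + 1)) (E (p + j)) := fun j =>
    MbackKernel G H hGm hHm (p + j) (θ (p + j))
  have hK : ∀ j, IsMarkovKernel (K j) := fun j =>
    isMarkovKernel_MbackKernel G H hGm hHm _ _ (h0 j) (htop j)
  let Q : ∀ q, Kernel (E q) (E (q + 1)) := QkKernel M G hGm
  have hQ : ∀ q, IsFiniteKernel (Q q) := isFiniteKernel_QkKernel M G hM hGm hG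
  have hdual : ∀ j, QQabs M G p η (p + j) ⊗ₘ Q (p + j)
      = (QQabs M G p η (p + j + 1) ⊗ₘ K j).map Prod.swap := fun j => by
    have hd := compProd_eq_map_swap_of_density (θ (p + j)) (Q (p + j)) (K j) (lam (p + j + 1))
      (fun x y => ENNReal.ofReal (G (p + j) x * H (p + j) x y))
      (((hGm _).comp measurable_fst).mul (hHm _)).ennreal_ofReal
      (Qk_eq_withDensity M G H lam hG hHm hMH _) (fun _ => rfl) (h0 j) (htop j)
    have hμ : QQabs M G p η (p + j) = QQabs M G p η (p + j) Set.univ • θ (p + j) :=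
      eq_smul_nz _ (hprop j).2
    have hμ' : QQabs M G p η (p + j + 1)
        = QQabs M G p η (p + j) Set.univ • (Q (p + j) ∘ₘ θ (p + j)) := by
      rw [← Measure.comp_smul, ← hμ]
      exact QQabs_add_succ M G p j η
    rw [hμ', Measure.compProd_smul_left, Measure.map_smul, ← hd, ← Measure.compProd_smul_left,
      ← hμ]
  obtain ⟨C, hC0, hC⟩ : ∃ C, 0 ≤ C ∧ ∀ x, |F x| ≤ C :=
    hFb.imp' (fun C => |C|) fun C hC => ⟨abs_nonneg C, fun x => (hC x).trans (le_abs_self C)⟩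
  clear hFb
  induction k generalizing C with
  | zero =>
    change ∫ x, F (pathSingle p x) ∂(QQabs M G p η p) = ∫ x, F (pathSingle p x) ∂η
    rw [QQabs_self]
  | succ k ih =>
    have := isMarkovKernel_bwdPath p K hK k
    have hs := measurable_pathSnoc (E := E) p k
    have hFs : Measurable fun z : (∀ i : Fin (k + 1), E (p + ↑i)) × E (p + k + 1) =>
      F (pathSnoc p k z.1 z.2) := hFm.comp hs
    have hFy : ∀ y, Measurable fun xs => F (pathSnoc p k xs y) := fun y =>
      hFs.comp measurable_prodMk_right
    have hQle : ∀ x : E (p + k), (Q (p + k) x).real Set.univ ≤ 1 := fun x => by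
      have := hM (p + k)
      change (Qk M G (p + k) x).real Set.univ ≤ 1
      simpa [Qk, Measure.real, (hG (p + k) x).1.le] using (hG (p + k) x).2
    have hQxC : ∀ x xs, |∫ y, F (pathSnoc p k xs y) ∂(Q (p + k) x)| ≤ C := fun x xs => by
      have h1 := norm_integral_le_of_norm_le_const (μ := Q (p + k) x)
        (f := fun y => F (pathSnoc p k xs y)) (C := C) (ae_of_all _ fun _ => hC _)
      exact h1.trans (mul_le_of_le_one_right hC0 (hQle x))
    let F' : (∀ i : Fin (k + 1), E (p + ↑i)) → ℝ := fun xs =>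
      ∫ y, F (pathSnoc p k xs y) ∂(Q (p + k) (xs (Fin.last k)))
    have hF'm : Measurable F' :=
      (StronglyMeasurable.integral_kernel_prod_right'
        (κ := (Q (p + k)).comap (fun xs : ∀ i : Fin (k + 1), E (p + ↑i) => xs (Fin.last k))
          (measurable_pi_apply _)) hFs.stronglyMeasurable).measurable
    have hF'C : ∀ xs, |F' xs| ≤ C := fun xs => hQxC _ xs
    let g : E (p + k) × E (p + k + 1) → ℝ := fun z =>
      ∫ xs, F (pathSnoc p k xs z.2) ∂(bwdPath p K k z.1)
    have hgm : Measurable g := by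
      have hm : Measurable fun w : (E (p + k) × E (p + k + 1)) × (∀ i : Fin (k + 1), E (p + ↑i)) =>
          F (pathSnoc p k w.2 w.1.2) :=
        hFs.comp (measurable_snd.prodMk (measurable_snd.comp measurable_fst))
      exact (StronglyMeasurable.integral_kernel_prod_right'
        (κ := Kernel.prodMkRight (E (p + k + 1)) (bwdPath p K k)) hm.stronglyMeasurable).measurable
    have hgC : ∀ z, |g z| ≤ C := fun z => by
      have h1 := norm_integral_le_of_norm_le_const (μ := bwdPath p K k z.1)
        (f := fun xs => F (pathSnoc p k xs z.2)) (C := C) (ae_of_all _ fun _ => hC _)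
      simpa using h1
    have hgeq : ∀ x y, bwdSeg G H θ p k x (fun xs => F (pathSnoc p k xs y)) = g (x, y) :=
      fun x y => bwdSeg_eq_integral G H p K hK θ k (fun _ _ _ => rfl) x _ (hFy y) fun _ => hC _
    have hF'seg : ∀ x, bwdSeg G H θ p k x F' = ∫ y, g (x, y) ∂(Q (p + k) x) := fun x => by
      have hm : Measurable fun xs => ∫ y, F (pathSnoc p k xs y) ∂(Q (p + k) x) :=
        (hFs.stronglyMeasurable.integral_prod_right (ν := Q (p + k) x)).measurable
      rw [bwdSeg_congr G H θ p k x F' (fun xs => ∫ y, F (pathSnoc p k xs y) ∂(Q (p + k) x))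
        (fun xs hxs => by simp only [F', hxs]),
        bwdSeg_eq_integral G H p K hK θ k (fun _ _ _ => rfl) x _ hm (hQxC x)]
      exact integral_integral_swap (f := fun xs y => F (pathSnoc p k xs y))
        (integrable_of_bounded hFs fun _ => hC _)
    calc ∫ x, bwdSeg G H θ p (k + 1) x F ∂(QQabs M G p η (p + (k + 1)))
        = ∫ y, ∫ x, g (x, y) ∂(K k y) ∂(QQabs M G p η (p + k + 1)) := by
          simp only [← hgeq]; rfl
      _ = ∫ z, g z.swap ∂(QQabs M G p η (p + k + 1) ⊗ₘ K k) := by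
          have : IsFiniteMeasure (QQabs M G p η (p + k + 1)) := hfinite (k + 1)
          exact (Measure.integral_compProd
            (integrable_of_bounded (hgm.comp measurable_swap) fun _ => hgC _)).symm
      _ = ∫ z, g z ∂(QQabs M G p η (p + k) ⊗ₘ Q (p + k)) := by
          rw [hdual, integral_map measurable_swap.aemeasurable hgm.aestronglyMeasurable]
      _ = ∫ x, bwdSeg G H θ p k x F' ∂(QQabs M G p η (p + k)) := by
          rw [Measure.integral_compProd (integrable_of_bounded hgm hgC)]
          simp only [hF'seg]
      _ = ∫ x, fwdSeg M G p k x F' ∂η := ih F' hF'm C hC0 hF'C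
      _ = ∫ x, fwdSeg M G p (k + 1) x F ∂η := rfl

end
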